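/- Let p ≥ 1, α > 0, β ∈ (0,1], x > 1, and f, g positive functions on [1,∞) with H^{α,β}_{1,x}[f^p](x) < ∞ and H^{α,β}_{1,x}[g^p](x) < ∞. If 0 < m ≤ f(τ)/g(τ) ≤ M for τ ∈ (1,x), then (H^{α,β}_{1,x}[f^p](x))^{2/p} + (H^{α,β}_{1,x}[g^p](x))^{2/p} ≥ ((M+1)(m+1)/M − 2) · (H^{α,β}_{1,x}[f^p](x))^{1/p} · (H^{α,β}_{1,x}[g^p](x))^{1/p}. -/

import Mathlib

open MeasureTheory Real

/-- Kernel of the generalized proportional Hadamard fractional integral. -/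
noncomputable def Hker (α β x : ℝ) (z : ℝ → ℝ) (t : ℝ) : ℝ :=
  Real.exp ((β - 1) / β * (Real.log x - Real.log t)) *
    (Real.log x - Real.log t) ^ (α - 1) * z t / t

/-- The one-sided generalized proportional Hadamard fractional integral
`H^{α,β}_{1,x}[z](x)`. -/
noncomputable def H (α β x : ℝ) (z : ℝ → ℝ) : ℝ :=
  (1 / (β ^ α * Real.Gamma α)) * ∫ t in Set.Ioo 1 x, Hker α β x z t

lemma Hker_weight_nonneg {α β x t : ℝ} (ht : t ∈ Set.Ioo 1 x) :
    0 ≤ Real.exp ((β - 1) / β * (Real.log x - Real.log t)) *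
      (Real.log x - Real.log t) ^ (α - 1) / t := by
  have ht0 : 0 < t := one_pos.trans ht.1
  have hlog : 0 ≤ Real.log x - Real.log t := sub_nonneg.2 (Real.log_le_log ht0 ht.2.le)
  positivity

lemma Hker_eq_weight_mul (α β x : ℝ) (z : ℝ → ℝ) (t : ℝ) :
    Hker α β x z t = Real.exp ((β - 1) / β * (Real.log x - Real.log t)) *
      (Real.log x - Real.log t) ^ (α - 1) / t * z t := by
  rw [Hker]; ring

lemma H_const_nonneg {α β : ℝ} (hα : 0 < α) (hβ : 0 < β) :
    0 ≤ 1 / (β ^ α * Real.Gamma α) := by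
  have := Real.Gamma_pos_of_pos hα
  positivity

lemma H_nonneg {α β x : ℝ} {z : ℝ → ℝ} (hα : 0 < α) (hβ : 0 < β)
    (hz : ∀ t ∈ Set.Ioo 1 x, 0 ≤ z t) : 0 ≤ H α β x z := by
  refine mul_nonneg (H_const_nonneg hα hβ) (setIntegral_nonneg measurableSet_Ioo fun t ht => ?_)
  rw [Hker_eq_weight_mul]
  exact mul_nonneg (Hker_weight_nonneg ht) (hz t ht)

lemma H_const_mul (α β x c : ℝ) (z : ℝ → ℝ) :
    H α β x (fun t => c * z t) = c * H α β x z := by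
  have h : Hker α β x (fun t => c * z t) = fun t => c * Hker α β x z t := by
    funext t
    simp only [Hker]
    ring
  rw [H, H, h, integral_const_mul]
  ring

lemma H_mono {α β x : ℝ} {z w : ℝ → ℝ} (hα : 0 < α) (hβ : 0 < β)
    (hz : IntegrableOn (Hker α β x z) (Set.Ioo 1 x))
    (hw : IntegrableOn (Hker α β x w) (Set.Ioo 1 x))
    (h : ∀ t ∈ Set.Ioo 1 x, z t ≤ w t) : H α β x z ≤ H α β x w := by
  refine mul_le_mul_of_nonneg_left
    (setIntegral_mono_on hz hw measurableSet_Ioo fun t ht => ?_) (H_const_nonneg hα hβ)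
  rw [Hker_eq_weight_mul, Hker_eq_weight_mul]
  exact mul_le_mul_of_nonneg_left (h t ht) (Hker_weight_nonneg ht)

lemma integrableOn_Hker_const_mul {α β x : ℝ} {z : ℝ → ℝ} (c : ℝ)
    (hz : IntegrableOn (Hker α β x z) (Set.Ioo 1 x)) :
    IntegrableOn (Hker α β x (fun t => c * z t)) (Set.Ioo 1 x) := by
  have h : Hker α β x (fun t => c * z t) = fun t => c * Hker α β x z t := by
    funext t
    simp only [Hker]
    ring
  rw [h]
  exact Integrable.const_mul hz c

/-- A pointwise bound `u ≤ c * v` passes to the `p`-norms attached to `H`. -/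
lemma H_rpow_le_const_mul {p α β x c : ℝ} {u v : ℝ → ℝ} (hp : 0 < p) (hα : 0 < α) (hβ : 0 < β)
    (hc : 0 ≤ c) (hu : ∀ t ∈ Set.Ioo 1 x, 0 ≤ u t) (hv : ∀ t ∈ Set.Ioo 1 x, 0 ≤ v t)
    (huint : IntegrableOn (Hker α β x (fun t => u t ^ p)) (Set.Ioo 1 x))
    (hvint : IntegrableOn (Hker α β x (fun t => v t ^ p)) (Set.Ioo 1 x))
    (h : ∀ t ∈ Set.Ioo 1 x, u t ≤ c * v t) :
    (H α β x fun t => u t ^ p) ^ (1 / p) ≤ c * (H α β x fun t => v t ^ p) ^ (1 / p) := by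
  have hv0 : 0 ≤ H α β x fun t => v t ^ p :=
    H_nonneg hα hβ fun t ht => Real.rpow_nonneg (hv t ht) p
  have hle : (H α β x fun t => u t ^ p) ≤ c ^ p * H α β x fun t => v t ^ p := by
    rw [← H_const_mul]
    refine H_mono hα hβ huint (integrableOn_Hker_const_mul _ hvint) fun t ht => ?_
    rw [← Real.mul_rpow hc (hv t ht)]
    exact Real.rpow_le_rpow (hu t ht) (h t ht) hp.le
  calc (H α β x fun t => u t ^ p) ^ (1 / p)
      ≤ (c ^ p * H α β x fun t => v t ^ p) ^ (1 / p) :=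
        Real.rpow_le_rpow (H_nonneg hα hβ fun t ht => Real.rpow_nonneg (hu t ht) p) hle
          (by positivity)
    _ = c * (H α β x fun t => v t ^ p) ^ (1 / p) := by
        rw [Real.mul_rpow (Real.rpow_nonneg hc p) hv0, ← Real.rpow_mul hc,
          mul_one_div_cancel hp.ne', Real.rpow_one]

lemma mul_le_sq_add_sq_of_ratio_bounds {m M a b : ℝ} (hm : 0 < m) (hM : 0 < M)
    (ha : 0 ≤ a) (hb : 0 ≤ b) (hma : m * b ≤ a) (haM : a ≤ M * b) :
    ((M + 1) * (m + 1) / M - 2) * (a * b) ≤ a ^ 2 + b ^ 2 := by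
  have h : ((M + 1) * a) * ((m + 1) * b) ≤ (M * (a + b)) * (a + b) :=
    mul_le_mul (by linarith) (by linarith) (by positivity) (by positivity)
  have h' : (M + 1) * (m + 1) / M * (a * b) ≤ (a + b) ^ 2 := by
    rw [div_mul_eq_mul_div, div_le_iff₀ hM]
    linarith
  linarith

theorem stmt_4 (p α β m M x : ℝ) (f g : ℝ → ℝ) (hp : 1 ≤ p) (hα : 0 < α)
    (hβ : β ∈ Set.Ioc (0:ℝ) 1) (hx : 1 < x)
    (hf : ∀ t ∈ Set.Ici (1:ℝ), 0 < f t) (hg : ∀ t ∈ Set.Ici (1:ℝ), 0 < g t)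
    (hfint : IntegrableOn (Hker α β x (fun t => f t ^ p)) (Set.Ioo 1 x))
    (hgint : IntegrableOn (Hker α β x (fun t => g t ^ p)) (Set.Ioo 1 x))
    (hm : 0 < m)
    (hbound : ∀ t ∈ Set.Ioo (1:ℝ) x, m ≤ f t / g t ∧ f t / g t ≤ M) :
    ((M + 1) * (m + 1) / M - 2) *
        ((H α β x fun t => f t ^ p) ^ (1 / p) * (H α β x fun t => g t ^ p) ^ (1 / p)) ≤
      (H α β x fun t => f t ^ p) ^ (2 / p) + (H α β x fun t => g t ^ p) ^ (2 / p) := by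
  have hp0 : 0 < p := one_pos.trans_le hp
  have hf' : ∀ t ∈ Set.Ioo 1 x, 0 < f t := fun t ht => hf t ht.1.le
  have hg' : ∀ t ∈ Set.Ioo 1 x, 0 < g t := fun t ht => hg t ht.1.le
  have hM : 0 < M := by
    obtain ⟨t, ht⟩ := Set.nonempty_Ioo.2 hx
    exact hm.trans_le ((hbound t ht).1.trans (hbound t ht).2)
  have hF : 0 ≤ H α β x fun t => f t ^ p :=
    H_nonneg hα hβ.1 fun t ht => Real.rpow_nonneg (hf' t ht).le p
  have hG : 0 ≤ H α β x fun t => g t ^ p :=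
    H_nonneg hα hβ.1 fun t ht => Real.rpow_nonneg (hg' t ht).le p
  have hFM := H_rpow_le_const_mul hp0 hα hβ.1 hM.le (fun t ht => (hf' t ht).le)
    (fun t ht => (hg' t ht).le) hfint hgint
    fun t ht => (div_le_iff₀ (hg' t ht)).1 (hbound t ht).2
  have hGm := H_rpow_le_const_mul hp0 hα hβ.1 (inv_nonneg.2 hm.le) (fun t ht => (hg' t ht).le)
    (fun t ht => (hf' t ht).le) hgint hfint
    fun t ht => (le_inv_mul_iff₀ hm).2 ((le_div_iff₀ (hg' t ht)).1 (hbound t ht).1)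
  have hsq : ∀ y : ℝ, 0 ≤ y → y ^ (2 / p) = (y ^ (1 / p)) ^ 2 := fun y hy => by
    rw [← Real.rpow_mul_natCast hy]
    congr 1
    push_cast
    ring
  rw [hsq _ hF, hsq _ hG]
  exact mul_le_sq_add_sq_of_ratio_bounds hm hM (Real.rpow_nonneg hF _) (Real.rpow_nonneg hG _)
    ((le_inv_mul_iff₀ hm).1 hGm) hFM
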